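/- Let K be a field, M ∈ K[x]^{m×n} of rank r, and N ∈ K[x]^{(m−r)×m} a matrix with NM = 0 whose rows are K(x)-linearly independent. The rows of N form a minimal basis of the left nullspace module of M if and only if N is row-reduced and irreducible. -/

import Mathlib

open Polynomial Matrix

namespace PolyNull

variable {K : Type*} [Field K]

/-- Degree of a polynomial row vector: max of `natDegree` of its entries. -/
noncomputable def vecDeg {m : Type*} [Fintype m] (v : m → Polynomial K) : ℕ :=
  Finset.univ.sup fun i => (v i).natDegree

/-- Degree of a polynomial matrix: max of degrees of its entries. -/
noncomputable def matDeg {m n : Type*} [Fintype m] [Fintype n]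
    (M : Matrix m n (Polynomial K)) : ℕ :=
  Finset.univ.sup fun ij : m × n => (M ij.1 ij.2).natDegree

/-- View a polynomial matrix as a matrix over the rational function field `K(x)`. -/
noncomputable def ratMat {m n : Type*} (M : Matrix m n (Polynomial K)) :
    Matrix m n (RatFunc K) :=
  M.map (algebraMap (Polynomial K) (RatFunc K))

/-- Rank of a polynomial matrix (its rank over `K(x)`). -/
noncomputable def polyRank {m n : Type*} [Fintype m] [Fintype n]
    (M : Matrix m n (Polynomial K)) : ℕ :=
  (ratMat M).rank

/-- The left nullspace `K[x]`-module of a polynomial matrix. -/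
noncomputable def leftNullMod {m n : Type*} [Fintype m] (M : Matrix m n (Polynomial K)) :
    Submodule (Polynomial K) (m → Polynomial K) :=
  LinearMap.ker M.vecMulLinear

/-- `N` is a family of rows forming a basis of the left nullspace module of `M`. -/
def IsNullBasis {m n ι : Type*} [Fintype m] (M : Matrix m n (Polynomial K))
    (N : ι → (m → Polynomial K)) : Prop :=
  LinearIndependent (Polynomial K) N ∧
    Submodule.span (Polynomial K) (Set.range N) = leftNullMod M

/-- Minimal basis of the left nullspace module: a basis whose sorted row degrees are
pointwise minimal among all bases; equivalently (order-free formulation), for every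
degree threshold it has at least as many rows of degree at most the threshold as
any other basis. -/
def IsMinimalNullBasis {m n ι : Type*} [Fintype m] [Fintype ι]
    (M : Matrix m n (Polynomial K)) (N : ι → (m → Polynomial K)) : Prop :=
  IsNullBasis M N ∧
    ∀ N' : ι → (m → Polynomial K), IsNullBasis M N' →
      ∀ δ : ℕ, (Finset.univ.filter fun i => vecDeg (N' i) ≤ δ).card
        ≤ (Finset.univ.filter fun i => vecDeg (N i) ≤ δ).card

open scoped Classical in
/-- McMillan degree of a rank-`r` polynomial matrix: the maximum of the degrees of the
determinants of its `r × r` submatrices. -/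
noncomputable def mcMillanDeg {m n : Type*} [Fintype m] [Fintype n]
    (M : Matrix m n (Polynomial K)) (r : ℕ) : ℕ :=
  Finset.univ.sup fun fg : (Fin r → m) × (Fin r → n) =>
    if Function.Injective fg.1 ∧ Function.Injective fg.2 then
      (M.submatrix fg.1 fg.2).det.natDegree
    else 0

/-- Rank of the evaluation of a polynomial matrix at a point of the algebraic closure. -/
noncomputable def evalRank {m n : Type*} [Fintype n]
    (M : Matrix m n (Polynomial K)) (x₀ : AlgebraicClosure K) : ℕ :=
  (M.map fun f => Polynomial.aeval x₀ f).rank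

/-- A polynomial matrix is irreducible (for its rank `r`) if it has rank `r` at every
point of the algebraic closure of `K`. -/
def IsIrreducibleMat {m n : Type*} [Fintype n]
    (M : Matrix m n (Polynomial K)) (r : ℕ) : Prop :=
  ∀ x₀ : AlgebraicClosure K, evalRank M x₀ = r

/-- Leading row coefficient matrix of a polynomial matrix. -/
noncomputable def leadingRowMatrix {k m : Type*} [Fintype m]
    (N : Matrix k m (Polynomial K)) : Matrix k m K :=
  fun i j => (N i j).coeff (vecDeg (N i))

/-- A polynomial matrix is row-reduced if its leading row coefficient matrix has full
row rank. -/
def IsRowReduced {k m : Type*} [Fintype k] [Fintype m]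
    (N : Matrix k m (Polynomial K)) : Prop :=
  (leadingRowMatrix N).rank = Fintype.card k

/-- `S` and `N` are left coprime: every non-singular common left divisor is unimodular. -/
def LeftCoprime {p n : Type*} [Fintype p] [DecidableEq p]
    (S : Matrix p p (Polynomial K)) (N : Matrix p n (Polynomial K)) : Prop :=
  ∀ U : Matrix p p (Polynomial K), U.det ≠ 0 →
    (∃ S', S = U * S') → (∃ N', N = U * N') → IsUnit U.det

/-- `C` and `T` are right coprime: every non-singular common right divisor is unimodular. -/
def RightCoprime {p n : Type*} [Fintype p] [DecidableEq p]
    (C : Matrix n p (Polynomial K)) (T : Matrix p p (Polynomial K)) : Prop :=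
  ∀ U : Matrix p p (Polynomial K), U.det ≠ 0 →
    (∃ C', C = C' * U) → (∃ T', T = T' * U) → IsUnit U.det

theorem rank_eq_card_iff {F k m : Type*} [Field F] [Fintype k] [Fintype m] (A : Matrix k m F) :
    A.rank = Fintype.card k ↔ ∀ c : k → F, c ᵥ* A = 0 → c = 0 := by
  have h : Function.Injective A.vecMul ↔ ∀ c : k → F, c ᵥ* A = 0 → c = 0 := by
    rw [← coe_vecMulLinear, injective_iff_map_eq_zero]
    simp
  rw [← h, vecMul_injective_iff, linearIndependent_iff_card_eq_finrank_span, Set.finrank,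
    ← rank_eq_finrank_span_row, eq_comm]

theorem le_vecDeg {m : Type*} [Fintype m] (v : m → Polynomial K) (i : m) :
    (v i).natDegree ≤ vecDeg v :=
  Finset.le_sup (f := fun i => (v i).natDegree) (Finset.mem_univ i)

/-- Predictable degree property. -/
theorem predictable {k m : Type*} [Fintype k] [Fintype m] (N : Matrix k m (Polynomial K))
    (hN : IsRowReduced N) (c : k → Polynomial K) (j : k) (hj : c j ≠ 0) :
    vecDeg (N j) ≤ vecDeg (c ᵥ* N) := by
  classical
  have hL := (rank_eq_card_iff _).1 hN
  let S := Finset.univ.filter fun j => c j ≠ 0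
  have hS : S.Nonempty := ⟨j, by simp [S, hj]⟩
  obtain ⟨t, htS, ht⟩ := S.exists_max_image (fun j => (c j).natDegree + vecDeg (N j)) hS
  have ht0 : c t ≠ 0 := by simpa [S] using htS
  set e := (c t).natDegree + vecDeg (N t) with he
  have hle : ∀ i, c i ≠ 0 → (c i).natDegree + vecDeg (N i) ≤ e := fun i hi =>
    ht i (by simp [S, hi])
  let a : k → K := fun i => if c i = 0 then 0 else (c i).coeff (e - vecDeg (N i))
  have hcoef : ∀ l, ((c ᵥ* N) l).coeff e = (a ᵥ* leadingRowMatrix N) l := by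
    intro l
    simp only [vecMul, dotProduct, finsetSum_coeff]
    refine Finset.sum_congr rfl fun i _ => ?_
    by_cases hi : c i = 0
    · simp [a, hi]
    · have h1 := hle i hi
      have h2 : e = (e - vecDeg (N i)) + vecDeg (N i) := by omega
      simp only [a, hi, if_false, leadingRowMatrix]
      conv_lhs => rw [h2]
      exact coeff_mul_add_eq_of_natDegree_le (by omega) (le_vecDeg (N i) l)
  have ha : a ≠ 0 := by
    intro h
    have := congrFun h t
    simp [a, ht0, he] at this
  have hne : a ᵥ* leadingRowMatrix N ≠ 0 := fun h => ha (hL a h)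
  obtain ⟨l, hl⟩ := Function.ne_iff.1 hne
  rw [← hcoef l] at hl
  have h3 := le_natDegree_of_ne_zero hl
  have h4 := le_vecDeg (c ᵥ* N) l
  have h5 := hle j hj
  omega

/-- Saturation of an irreducible matrix. -/
theorem saturated {k m : Type*} [Fintype k] [Fintype m] (N : Matrix k m (Polynomial K))
    (hN : IsIrreducibleMat N (Fintype.card k)) :
    ∀ (d : ℕ) (p : Polynomial K), p.natDegree = d → p ≠ 0 →
      ∀ (c : k → Polynomial K) (v : m → Polynomial K), p • v = c ᵥ* N →
      ∃ c', v = c' ᵥ* N := by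
  intro d
  induction d using Nat.strong_induction_on with
  | _ d ih =>
  intro p hd hp c v hv
  by_cases hd0 : d = 0
  · obtain ⟨a, ha⟩ := natDegree_eq_zero.1 (hd.trans hd0)
    have ha0 : a ≠ 0 := by rintro rfl; simp at ha; exact hp ha.symm
    refine ⟨C a⁻¹ • c, ?_⟩
    rw [smul_vecMul, ← hv, ← ha, smul_smul, ← C_mul, inv_mul_cancel₀ ha0]
    simp
  · have hdeg : (p.map (algebraMap K (AlgebraicClosure K))).degree ≠ 0 := by
      rw [degree_map]
      intro h
      exact hd0 (hd ▸ natDegree_eq_zero_iff_degree_le_zero.2 h.le)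
    obtain ⟨x, hx⟩ := IsAlgClosed.exists_root _ hdeg
    have hpx : aeval x p = 0 := by
      rwa [IsRoot, eval_map_algebraMap] at hx
    have hcx : (fun i => aeval x (c i)) = 0 := by
      refine (rank_eq_card_iff _).1 (hN x) _ ?_
      ext l
      have := congrArg (aeval x) (congrFun hv l)
      simp only [Pi.smul_apply, smul_eq_mul, map_mul, hpx, zero_mul, vecMul, dotProduct,
        map_sum] at this
      simp only [vecMul, dotProduct, Matrix.map_apply, Pi.zero_apply]
      exact this.symm
    obtain ⟨p', hp'⟩ := minpoly.dvd K x hpx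
    choose c' hc' using fun i => minpoly.dvd K x (congrFun hcx i)
    have hint : IsIntegral K x := Algebra.IsIntegral.isIntegral x
    have hq := minpoly.ne_zero hint
    have hqd := minpoly.natDegree_pos hint
    have hp'0 : p' ≠ 0 := by rintro rfl; simp at hp'; exact hp hp'
    have hdeg' : p'.natDegree < d := by
      rw [← hd, hp', natDegree_mul hq hp'0]; omega
    refine ih _ hdeg' p' rfl hp'0 c' v ?_
    have hc'' : c = minpoly K x • c' := funext hc'
    rw [hc'', smul_vecMul, hp', mul_smul] at hv
    exact smul_right_injective _ hq hv

/-- Over the fraction field, everything in the left nullspace is a combination of rows of `N`. -/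
theorem exists_multiple {m n r : ℕ} (M : Matrix (Fin m) (Fin n) (Polynomial K))
    (hr : polyRank M = r)
    (N : Matrix (Fin (m - r)) (Fin m) (Polynomial K))
    (hNM : N * M = 0)
    (hind : LinearIndependent (RatFunc K) fun i => ratMat N i)
    (v : Fin m → Polynomial K) (hv : v ᵥ* M = 0) :
    ∃ p : Polynomial K, p ≠ 0 ∧ ∃ c, p • v = c ᵥ* N := by
  set φ := algebraMap (Polynomial K) (RatFunc K) with hφ
  have hφi : Function.Injective φ := IsFractionRing.injective _ _
  have hmap : ratMat N * ratMat M = 0 := by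
    simp only [ratMat]
    rw [← Matrix.map_mul, hNM]; simp
  have hker : Submodule.span (RatFunc K) (Set.range (ratMat N).row) =
      LinearMap.ker (ratMat M).vecMulLinear := by
    apply Submodule.eq_of_le_of_finrank_eq
    · rw [Submodule.span_le]
      rintro _ ⟨i, rfl⟩
      simp only [SetLike.mem_coe, LinearMap.mem_ker, vecMulLinear_apply]
      have := congrFun hmap i
      rw [Matrix.mul_apply_eq_vecMul] at this
      exact this
    · have h1 := LinearMap.finrank_range_add_finrank_ker (ratMat M).vecMulLinear
      rw [range_vecMulLinear, ← rank_eq_finrank_span_row] at h1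
      rw [finrank_span_eq_card (b := (ratMat N).row) hind]
      simp only [polyRank] at hr
      simp only [Module.finrank_fintype_fun_eq_card, Fintype.card_fin] at h1 ⊢
      omega
  have hvm : (fun i => φ (v i)) ∈ LinearMap.ker (ratMat M).vecMulLinear := by
    simp only [LinearMap.mem_ker, vecMulLinear_apply]
    ext l
    have := congrArg φ (congrFun hv l)
    simpa [vecMul, dotProduct, ratMat] using this
  rw [← hker, ← range_vecMulLinear] at hvm
  obtain ⟨q, hq⟩ := hvm
  obtain ⟨b, hb⟩ := IsLocalization.exist_integer_multiples_of_finite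
    (nonZeroDivisors (Polynomial K)) q
  choose c hc using hb
  refine ⟨b, nonZeroDivisors.coe_ne_zero b, c, ?_⟩
  ext1 l
  apply hφi
  have hl := congrFun hq l
  simp only [vecMulLinear_apply, vecMul, dotProduct, ratMat, Matrix.map_apply] at hl
  simp only [Pi.smul_apply, smul_eq_mul, map_mul, vecMul, dotProduct, map_sum]
  rw [← hl, Finset.mul_sum]
  refine Finset.sum_congr rfl fun i _ => ?_
  rw [← hφ] at hc
  rw [hc, Algebra.smul_def]
  ring

theorem mem_span_rows {R k m : Type*} [CommRing R] [Fintype k] (N : Matrix k m R)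
    (v : m → R) : v ∈ Submodule.span R (Set.range N) ↔ ∃ c, v = c ᵥ* N := by
  change v ∈ Submodule.span R (Set.range N.row) ↔ _
  rw [← range_vecMulLinear]
  simp [eq_comm]

/-- A basis of the left nullspace is irreducible. -/
theorem irreducible_of_basis {m n k : ℕ} (M : Matrix (Fin m) (Fin n) (Polynomial K))
    (N : Matrix (Fin k) (Fin m) (Polynomial K)) (h : IsNullBasis M (fun i => N i)) :
    IsIrreducibleMat N k := by
  classical
  obtain ⟨hli, hsp⟩ := h
  have hinj : Function.Injective N.vecMul := vecMul_injective_iff.2 hli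
  obtain ⟨s, hs⟩ := Module.projective_lifting_property M.vecMulLinear.rangeRestrict
    LinearMap.id M.vecMulLinear.surjective_rangeRestrict
  have hproj : ∀ w : Fin m → Polynomial K, ∃ c : Fin k → Polynomial K,
      w - s (M.vecMulLinear.rangeRestrict w) = c ᵥ* N := by
    intro w
    rw [← mem_span_rows]
    change _ ∈ Submodule.span _ (Set.range fun i => N i)
    rw [hsp]
    simp only [leftNullMod, LinearMap.mem_ker, map_sub]
    have := congrArg Subtype.val (LinearMap.congr_fun hs (M.vecMulLinear.rangeRestrict w))
    exact sub_eq_zero.2 this.symm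
  choose V hV using fun j : Fin m => hproj (Pi.single j 1)
  have hNV : N * Matrix.of V = 1 := by
    have key : N * Matrix.of V * N = (1 : Matrix (Fin k) (Fin k) (Polynomial K)) * N := by
      funext i
      have hrow : M.vecMulLinear.rangeRestrict (N i) = 0 := by
        apply Subtype.ext
        have : N i ∈ leftNullMod M := hsp ▸ Submodule.subset_span ⟨i, rfl⟩
        exact this
      have h2 : N i = ∑ j, N i j • (Pi.single j 1 : Fin m → Polynomial K) := by
        rw [← pi_eq_sum_univ']
      have h3 : Matrix.of V * N = Matrix.of fun j =>
          (Pi.single j 1 : Fin m → Polynomial K) -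
            s (M.vecMulLinear.rangeRestrict (Pi.single j 1)) := by
        funext j
        rw [Matrix.mul_apply_eq_vecMul]
        exact (hV j).symm
      rw [Matrix.mul_assoc, Matrix.mul_apply_eq_vecMul, Matrix.one_mul, h3]
      rw [vecMul_eq_sum]
      have h4 : ∑ j, N i j • ((Pi.single j 1 : Fin m → Polynomial K) -
            s (M.vecMulLinear.rangeRestrict (Pi.single j 1))) = N i := by
        simp only [smul_sub, Finset.sum_sub_distrib]
        rw [← h2]
        simp only [← map_smul, ← map_sum]
        rw [← h2, hrow, map_zero, sub_zero]
      exact h4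
    funext i
    apply hinj
    have := congrFun key i
    rwa [Matrix.mul_apply_eq_vecMul, Matrix.mul_apply_eq_vecMul] at this
  intro x
  have hk : k = Fintype.card (Fin k) := by simp
  unfold evalRank
  conv_rhs => rw [hk]
  rw [rank_eq_card_iff]
  intro c hc
  have h1 : (N.map fun f => aeval x f) * ((Matrix.of V).map fun f => aeval x f) = 1 := by
    have := congrArg (fun A => A.map (aeval x : Polynomial K →ₐ[K] AlgebraicClosure K)) hNV
    simpa [Matrix.map_mul] using this
  have h2 := congrArg (fun w => w ᵥ* ((Matrix.of V).map fun f => aeval x f)) hc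
  simp only [vecMul_vecMul] at h2
  rw [h1] at h2
  simpa using h2

theorem rowReduced_of_minimal {m n k : ℕ} (M : Matrix (Fin m) (Fin n) (Polynomial K))
    (N : Matrix (Fin k) (Fin m) (Polynomial K)) (h : IsMinimalNullBasis M (fun i => N i)) :
    IsRowReduced N := by
  classical
  obtain ⟨⟨hli, hsp⟩, hmin⟩ := h
  have hinj : Function.Injective N.vecMul := vecMul_injective_iff.2 hli
  by_contra hN
  unfold IsRowReduced at hN
  rw [rank_eq_card_iff] at hN
  push Not at hN
  obtain ⟨a, ha, ha0⟩ := hN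
  let S := Finset.univ.filter fun j => a j ≠ 0
  have hS : S.Nonempty := by
    obtain ⟨j, hj⟩ := Function.ne_iff.1 ha0
    exact ⟨j, by simpa [S] using hj⟩
  obtain ⟨t, htS, ht⟩ := S.exists_max_image (fun j => vecDeg (N j)) hS
  have ht0 : a t ≠ 0 := by simpa [S] using htS
  have hle : ∀ i, a i ≠ 0 → vecDeg (N i) ≤ vecDeg (N t) := fun i hi => ht i (by simp [S, hi])
  set e := vecDeg (N t) with he
  let c : Fin k → Polynomial K := fun i => monomial (e - vecDeg (N i)) (a i)
  have hct : c t = C (a t) := by simp [c, he]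
  set v := c ᵥ* N with hv
  have hcoef : ∀ l, (v l).coeff e = 0 := by
    intro l
    refine Eq.trans ?_ (congrFun ha l)
    simp only [hv, vecMul, dotProduct, finsetSum_coeff]
    refine Finset.sum_congr rfl fun i _ => ?_
    by_cases hi : a i = 0
    · simp [c, hi]
    · have h1 := hle i hi
      have h2 : e = (e - vecDeg (N i)) + vecDeg (N i) := by omega
      conv_lhs => rw [h2]
      rw [coeff_mul_add_eq_of_natDegree_le (natDegree_monomial_le _) (le_vecDeg (N i) l)]
      simp [leadingRowMatrix]
  have hdeg : ∀ l, (v l).natDegree ≤ e := by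
    intro l
    simp only [hv, vecMul, dotProduct]
    refine natDegree_sum_le_of_forall_le _ _ fun i _ => ?_
    by_cases hi : a i = 0
    · simp [c, hi]
    · have h1 := hle i hi
      refine natDegree_mul_le.trans ?_
      have h3 := le_vecDeg (N i) l
      have h4 : (c i).natDegree ≤ _ := natDegree_monomial_le _
      omega
  have hc0 : c ≠ 0 := by
    intro h
    have := congrFun h t
    rw [hct] at this
    simp [ht0] at this
  have hv0 : v ≠ 0 := by
    intro h
    apply hc0
    apply hinj
    simp only [← hv, h, zero_vecMul]
  have hlt : ∀ l, v l ≠ 0 → (v l).natDegree < e := by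
    intro l hl
    refine lt_of_le_of_ne (hdeg l) fun h => ?_
    have := hcoef l
    rw [← h] at this
    exact hl (leadingCoeff_eq_zero.1 this)
  have hepos : 0 < e := by
    obtain ⟨l, hl⟩ := Function.ne_iff.1 hv0
    have := hlt l hl
    omega
  have hvdeg : vecDeg v ≤ e - 1 := by
    refine Finset.sup_le fun l _ => ?_
    by_cases hl : v l = 0
    · simp [hl]
    · have := hlt l hl
      omega
  let N' : Fin k → Fin m → Polynomial K := Function.update (fun i => N i) t v
  have hN't : N' t = v := by simp [N']
  have hN'n : ∀ i, i ≠ t → N' i = N i := fun i hi => by simp [N', hi]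
  have hspan : Submodule.span (Polynomial K) (Set.range N') =
      Submodule.span (Polynomial K) (Set.range fun i => N i) := by
    have hvsum : v = c t • N t + ∑ i ∈ Finset.univ.erase t, c i • N i := by
      rw [hv, vecMul_eq_sum, Finset.add_sum_erase _ (fun i => c i • N i) (Finset.mem_univ t)]
    apply le_antisymm
    · rw [Submodule.span_le]
      rintro _ ⟨i, rfl⟩
      by_cases hi : i = t
      · subst hi
        rw [hN't]
        exact (mem_span_rows N v).2 ⟨c, rfl⟩
      · rw [hN'n i hi]
        exact Submodule.subset_span ⟨i, rfl⟩
    · rw [Submodule.span_le]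
      rintro _ ⟨i, rfl⟩
      by_cases hi : i = t
      · subst hi
        have h1 : N i = C (a i)⁻¹ • (v - ∑ j ∈ Finset.univ.erase i, c j • N j) := by
          rw [hvsum, add_sub_cancel_right, hct, smul_smul, ← C_mul, inv_mul_cancel₀ ht0]
          simp
        change N i ∈ _
        rw [h1]
        refine Submodule.smul_mem _ _ (Submodule.sub_mem _ ?_ (Submodule.sum_mem _ ?_))
        · exact Submodule.subset_span ⟨i, hN't⟩
        · intro j hj
          exact Submodule.smul_mem _ _
            (Submodule.subset_span ⟨j, hN'n j (Finset.ne_of_mem_erase hj)⟩)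
      · exact Submodule.subset_span ⟨i, hN'n i hi⟩
  have hli' : LinearIndependent (Polynomial K) N' := by
    rw [linearIndependent_iff_card_eq_finrank_span, Set.finrank, hspan]
    exact linearIndependent_iff_card_eq_finrank_span.1 hli
  have hcard := hmin N' ⟨hli', hspan.trans hsp⟩ (e - 1)
  refine absurd hcard (not_le.2 (Finset.card_lt_card ?_))
  rw [Finset.ssubset_iff_of_subset]
  · refine ⟨t, by simpa [hN't] using hvdeg, ?_⟩
    simp only [Finset.mem_filter, Finset.mem_univ, true_and]
    omega
  · intro i
    simp only [Finset.mem_filter, Finset.mem_univ, true_and]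
    intro hi
    have : i ≠ t := by rintro rfl; omega
    rwa [hN'n i this]

theorem minimal_of_rowReduced {m n k : ℕ} (M : Matrix (Fin m) (Fin n) (Polynomial K))
    (N : Matrix (Fin k) (Fin m) (Polynomial K)) (hb : IsNullBasis M (fun i => N i))
    (hN : IsRowReduced N) : IsMinimalNullBasis M (fun i => N i) := by
  classical
  refine ⟨hb, fun N' hN' δ => ?_⟩
  set A := Finset.univ.filter fun i => vecDeg (N' i) ≤ δ
  set B := Finset.univ.filter fun i => vecDeg (N i) ≤ δ with hB
  have hli : LinearIndependent (Polynomial K) fun i : A => N' i :=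
    hN'.1.comp _ Subtype.val_injective
  have h := linearIndependent_le_span_aux' (fun i : A => N' i) hli
    ((B.image fun i => N i : Finset (Fin m → Polynomial K)) : Set (Fin m → Polynomial K)) ?_
  · have h2 : (B.image fun i => N i).card ≤ B.card := Finset.card_image_le
    simp only [Finset.coe_sort_coe, Fintype.card_coe] at h
    exact h.trans h2
  · rintro _ ⟨⟨i, hi⟩, rfl⟩
    have hi' : vecDeg (N' i) ≤ δ := by simpa [A] using hi
    have hmem : N' i ∈ Submodule.span (Polynomial K) (Set.range N) := by
      have : N' i ∈ leftNullMod M := hN'.2 ▸ Submodule.subset_span ⟨i, rfl⟩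
      rw [← hb.2] at this
      exact this
    obtain ⟨c, hc⟩ := (mem_span_rows N _).1 hmem
    change N' i ∈ Submodule.span _ _
    rw [hc, vecMul_eq_sum]
    refine Submodule.sum_mem _ fun j _ => ?_
    by_cases hj : c j = 0
    · rw [hj, zero_smul]; exact Submodule.zero_mem _
    · refine Submodule.smul_mem _ _ (Submodule.subset_span ?_)
      have := predictable N hN c j hj
      rw [← hc] at this
      rw [Finset.mem_coe]
      exact Finset.mem_image_of_mem (fun i => N i) (by simpa [hB] using this.trans hi')

/-- For `N` with `N M = 0` and `K(x)`-linearly independent rows, the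
rows of `N` form a minimal basis of the left nullspace module of `M` iff `N` is
row-reduced and irreducible. -/
theorem minimal_basis_iff_rowReduced_irreducible
    {m n r : ℕ} (M : Matrix (Fin m) (Fin n) (Polynomial K))
    (hr : polyRank M = r)
    (N : Matrix (Fin (m - r)) (Fin m) (Polynomial K))
    (hNM : N * M = 0)
    (hind : LinearIndependent (RatFunc K) fun i => ratMat N i) :
    IsMinimalNullBasis M (fun i => N i) ↔
      IsRowReduced N ∧ IsIrreducibleMat N (m - r) := by
  constructor
  · intro h
    exact ⟨rowReduced_of_minimal M N h, irreducible_of_basis M N h.1⟩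
  · rintro ⟨h1, h2⟩
    refine minimal_of_rowReduced M N ⟨?_, ?_⟩ h1
    · change LinearIndependent (Polynomial K) N.row
      rw [← vecMul_injective_iff, ← coe_vecMulLinear, injective_iff_map_eq_zero]
      intro c hc
      have hz := vecMul_injective_iff.2 (show LinearIndependent (RatFunc K) (ratMat N).row from hind)
      have h0 : (fun i => algebraMap (Polynomial K) (RatFunc K) (c i)) = 0 := by
        apply hz
        ext l
        have := congrArg (algebraMap (Polynomial K) (RatFunc K)) (congrFun hc l)
        simpa [vecMul, dotProduct, ratMat] using this
      ext1 i
      exact IsFractionRing.injective (Polynomial K) (RatFunc K) (by simpa using congrFun h0 i)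
    · apply le_antisymm
      · rw [Submodule.span_le]
        rintro _ ⟨i, rfl⟩
        have := congrFun hNM i
        rw [Matrix.mul_apply_eq_vecMul] at this
        exact this
      · intro v hv
        obtain ⟨p, hp, c, hc⟩ := exists_multiple M hr N hNM hind v hv
        refine (mem_span_rows N v).2 ?_
        exact saturated N (by simpa using h2) _ p rfl hp c v hc

end PolyNull
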